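/- arXiv:1006.5501 — 4 statements merged into one kernel-verified Lean document; each statement's English description precedes it below -/
import Mathlib

section
/- Let A be a unital C*-algebra and let a, b, x ∈ A with 0 ≤ a ≤ b ≤ 1 (in the canonical order on self-adjoint elements). Then ‖x − b·x‖² ≤ ‖x‖ · ‖x − a·x‖. -/
/-- Let `A` be a unital C*-algebra and `a b x ∈ A` with `0 ≤ a ≤ b ≤ 1` in the canonical
order on self-adjoint elements. Then `‖x - b * x‖ ^ 2 ≤ ‖x‖ * ‖x - a * x‖`. -/
theorem norm_sub_mul_sq_le {A : Type*} [CStarAlgebra A] [PartialOrder A] [StarOrderedRing A]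
    (a b x : A) (ha : 0 ≤ a) (hab : a ≤ b) (hb : b ≤ 1) :
    ‖x - b * x‖ ^ 2 ≤ ‖x‖ * ‖x - a * x‖ := by
  have hc : 0 ≤ 1 - b := sub_nonneg.mpr hb
  have hsq : (1 - b) ^ 2 ≤ 1 - a := calc
    (1 - b) ^ 2 ≤ (1 - b) ^ 1 :=
      CStarAlgebra.pow_antitone hc (sub_le_self 1 (ha.trans hab)) one_le_two
    _ ≤ 1 - a := by rw [pow_one]; exact sub_le_sub_left hab 1
  have hstar : star (x - b * x) * (x - b * x) = star x * (1 - b) ^ 2 * x := by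
    have hbs : star b = b := (IsSelfAdjoint.of_nonneg (ha.trans hab)).star_eq
    rw [star_sub, star_mul, hbs]
    noncomm_ring
  calc ‖x - b * x‖ ^ 2 = ‖star x * (1 - b) ^ 2 * x‖ := by
        rw [← hstar, CStarRing.norm_star_mul_self, sq]
    _ ≤ ‖star x * (1 - a) * x‖ :=
        CStarAlgebra.norm_le_norm_of_nonneg_of_le
          (star_left_conjugate_nonneg (CStarAlgebra.pow_nonneg hc 2) x)
          (star_left_conjugate_le_conjugate hsq x)
    _ = ‖star x * (x - a * x)‖ := by rw [mul_assoc, sub_mul, one_mul]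
    _ ≤ ‖x‖ * ‖x - a * x‖ := by
        simpa only [norm_star] using norm_mul_le (star x) (x - a * x)
end

section
/- Let A be a simple unital C*-algebra with a unique tracial state τ. Then the fundamental group 𝓕(A) = { (τ⊗Tr)(p) : n ∈ ℕ, p a projection in M_n(A) such that pM_n(A)p is *-isomorphic to A } is a subgroup of the multiplicative group of positive real numbers: every element of 𝓕(A) is strictly positive, 1 ∈ 𝓕(A), and 𝓕(A) is closed under multiplication and under taking inverses. -/
open scoped ComplexOrder

/-- A *tracial state* on a unital C*-algebra `A` is a positive linear functional `τ` with
`τ(1) = 1` satisfying `τ(ab) = τ(ba)` for all `a b ∈ A`. -/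
def IsTracialState {A : Type*} [CStarAlgebra A] (τ : A →L[ℂ] ℂ) : Prop :=
  (∀ a : A, 0 ≤ τ (star a * a)) ∧ τ 1 = 1 ∧ ∀ a b : A, τ (a * b) = τ (b * a)

/-- The corner `p·M_n(A)·p` of the matrix algebra `M_n(A)` determined by a projection `p`
(`p * p = p`, `star p = p`), described as `{x | p * x = x ∧ x * p = x}` and bundled as a
non-unital star subalgebra of `M_n(A)`. -/
def corner {A : Type*} [CStarAlgebra A] {n : ℕ} (p : Matrix (Fin n) (Fin n) A)
    (hp : p * p = p) (hps : star p = p) :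
    NonUnitalStarSubalgebra ℂ (Matrix (Fin n) (Fin n) A) where
  carrier := {x | p * x = x ∧ x * p = x}
  add_mem' := fun hx hy => ⟨by rw [mul_add, hx.1, hy.1], by rw [add_mul, hx.2, hy.2]⟩
  zero_mem' := ⟨mul_zero p, zero_mul p⟩
  mul_mem' := fun {x y} hx hy => ⟨by rw [← mul_assoc, hx.1], by rw [mul_assoc, hy.2]⟩
  smul_mem' := fun c x hx => ⟨by rw [mul_smul_comm, hx.1], by rw [smul_mul_assoc, hx.2]⟩
  star_mem' := fun {x} hx =>
    ⟨by rw [← hps, ← star_mul, hx.2], by rw [← hps, ← star_mul, hx.1]⟩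

/-- The fundamental group `𝓕(A)` of a unital C*-algebra `A` equipped with a tracial state `τ`:
the set of values `(τ ⊗ Tr)(p)` where `p` ranges over the projections in some matrix algebra
`M_n(A)` whose corner `p·M_n(A)·p` is *-isomorphic to `A`. -/
noncomputable def fundGroup (A : Type*) [CStarAlgebra A] (τ : A →L[ℂ] ℂ) : Set ℝ :=
  {t : ℝ | ∃ (n : ℕ) (p : Matrix (Fin n) (Fin n) A) (hp : p * p = p) (hps : star p = p),
    Nonempty ((corner p hp hps) ≃⋆ₐ[ℂ] A) ∧ t = (∑ i, τ (p i i)).re}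

/-- A *-homomorphism `F : A → M_ι(A)` is a *corner embedding* if it is injective and its range
is the corner of `M_ι(A)` at the projection `F 1`. -/
def IsCornerEmbedding {A ι : Type*} [CStarAlgebra A] [Fintype ι]
    (F : A →⋆ₙₐ[ℂ] Matrix ι ι A) : Prop :=
  Function.Injective F ∧ ∀ x, F 1 * x = x → x * F 1 = x → ∃ a, F a = x

section Embeddings

variable {A : Type*} [CStarAlgebra A] {ι κ : Type*} [Fintype ι] [Fintype κ]

lemma exists_isCornerEmbedding {τ : A →L[ℂ] ℂ} {t : ℝ} (ht : t ∈ fundGroup A τ) :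
    ∃ (n : ℕ) (F : A →⋆ₙₐ[ℂ] Matrix (Fin n) (Fin n) A),
      IsCornerEmbedding F ∧ t = (∑ i, τ (F 1 i i)).re := by
  obtain ⟨n, p, hp, hps, ⟨φ⟩, rfl⟩ := ht
  let F : A →⋆ₙₐ[ℂ] Matrix (Fin n) (Fin n) A :=
    { toFun := fun a => (φ.symm a : Matrix (Fin n) (Fin n) A)
      map_smul' := fun c a => by simp
      map_zero' := by simp
      map_add' := fun a b => by simp
      map_mul' := fun a b => by simp
      map_star' := fun a => by rw [map_star]; rfl }
  have hF : ∀ a, F a = (φ.symm a : Matrix (Fin n) (Fin n) A) := fun _ => rfl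
  have surj : ∀ x, p * x = x → x * p = x → ∃ a, F a = x := fun x h₁ h₂ =>
    ⟨φ ⟨x, h₁, h₂⟩, by simp [hF]⟩
  have h1 : F 1 = p := by
    obtain ⟨a, ha⟩ := surj p hp hp
    have h₁ : p * F 1 = F 1 := (φ.symm 1).2.1
    rw [← h₁, ← ha, ← map_mul, mul_one]
  refine ⟨n, F, ⟨fun a b hab => φ.symm.injective (Subtype.ext hab), ?_⟩, by rw [h1]⟩
  rwa [h1]

lemma mem_fundGroup_of_isCornerEmbedding (τ : A →L[ℂ] ℂ) {F : A →⋆ₙₐ[ℂ] Matrix ι ι A}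
    (hF : IsCornerEmbedding F) : (∑ i, τ (F 1 i i)).re ∈ fundGroup A τ := by
  let e : Fin (Fintype.card ι) ≃ ι := (Fintype.equivFin ι).symm
  have hmul : ∀ x y : Matrix ι ι A,
      x.submatrix e e * y.submatrix e e = (x * y).submatrix e e :=
    fun x y => Matrix.submatrix_mul_equiv x y e e e
  have hp : (F 1).submatrix e e * (F 1).submatrix e e = (F 1).submatrix e e := by
    rw [hmul, ← map_mul, mul_one]
  have hps : star ((F 1).submatrix e e) = (F 1).submatrix e e := by
    rw [Matrix.star_eq_conjTranspose, Matrix.conjTranspose_submatrix,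
      ← Matrix.star_eq_conjTranspose, ← map_star, star_one]
  let G : A →⋆ₙₐ[ℂ] corner ((F 1).submatrix e e) hp hps :=
    { toFun := fun a => ⟨(F a).submatrix e e, by rw [hmul, ← map_mul, one_mul],
        by rw [hmul, ← map_mul, mul_one]⟩
      map_smul' := fun c a => Subtype.ext <| by simp [Matrix.submatrix_smul]
      map_zero' := Subtype.ext <| by simp
      map_add' := fun a b => Subtype.ext <| by simp [Matrix.submatrix_add]
      map_mul' := fun a b => Subtype.ext <| by simp
      map_star' := fun a => Subtype.ext <| by
        change (F (star a)).submatrix e e = star ((F a).submatrix e e)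
        rw [map_star, Matrix.star_eq_conjTranspose, Matrix.star_eq_conjTranspose,
          Matrix.conjTranspose_submatrix] }
  have hG : Function.Bijective G := by
    constructor
    · intro a b hab
      have h : (F a).submatrix e e = (F b).submatrix e e := congrArg Subtype.val hab
      apply hF.1
      ext i j
      simpa using congrFun₂ h (e.symm i) (e.symm j)
    · rintro ⟨x, h₁, h₂⟩
      obtain ⟨y, rfl⟩ : ∃ y : Matrix ι ι A, y.submatrix e e = x :=
        ⟨x.submatrix e.symm e.symm, by simp⟩
      have inj : Function.Injective fun y : Matrix ι ι A => y.submatrix e e :=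
        (Matrix.reindex e.symm e.symm).injective
      rw [hmul] at h₁ h₂
      obtain ⟨a, rfl⟩ := hF.2 y (inj h₁) (inj h₂)
      exact ⟨a, rfl⟩
  refine ⟨_, _, hp, hps, ⟨(StarAlgEquiv.ofBijective G hG).symm⟩, ?_⟩
  simp only [Matrix.submatrix_apply]
  rw [e.sum_comp (fun i => τ (F 1 i i))]

/-- The composition `A → M_κ(A) → M_κ(M_ι(A)) ≅ M_{κ × ι}(A)` of two *-homomorphisms. -/
noncomputable def compEmbedding (F : A →⋆ₙₐ[ℂ] Matrix ι ι A) (G : A →⋆ₙₐ[ℂ] Matrix κ κ A) :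
    A →⋆ₙₐ[ℂ] Matrix (κ × ι) (κ × ι) A where
  toFun a := Matrix.comp κ κ ι ι A ((G a).map F)
  map_smul' c a := by ext; simp
  map_zero' := by ext; simp
  map_add' a b := by ext; simp
  map_mul' a b := by
    ext x y
    simp [Matrix.mul_apply, Fintype.sum_prod_type, Matrix.sum_apply]
  map_star' a := by
    ext x y
    change F (G (star a) x.1 y.1) x.2 y.2 = star (F (G a y.1 x.1) y.2 x.2)
    rw [map_star, Matrix.star_apply, map_star, Matrix.star_apply]

lemma compEmbedding_apply (F : A →⋆ₙₐ[ℂ] Matrix ι ι A) (G : A →⋆ₙₐ[ℂ] Matrix κ κ A) (a : A) :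
    compEmbedding F G a = Matrix.comp κ κ ι ι A ((G a).map F) := rfl

lemma IsCornerEmbedding.comp {F : A →⋆ₙₐ[ℂ] Matrix ι ι A} {G : A →⋆ₙₐ[ℂ] Matrix κ κ A}
    (hF : IsCornerEmbedding F) (hG : IsCornerEmbedding G) :
    IsCornerEmbedding (compEmbedding F G) := by
  have hFF : ∀ a, F 1 * F a = F a := fun a => by rw [← map_mul, one_mul]
  have hFF' : ∀ a, F a * F 1 = F a := fun a => by rw [← map_mul, mul_one]
  constructor
  · intro a b hab
    apply hG.1
    exact Matrix.map_injective hF.1 ((Matrix.comp κ κ ι ι A).injective hab)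
  · intro x h₁ h₂
    obtain ⟨y, rfl⟩ := (Matrix.compRingEquiv κ ι A).surjective x
    change Matrix.compRingEquiv κ ι A ((G 1).map F) * _ = _ at h₁
    change _ * Matrix.compRingEquiv κ ι A ((G 1).map F) = _ at h₂
    rw [← map_mul, EquivLike.apply_eq_iff_eq] at h₁ h₂
    have hy : ∀ i j, ∃ a, F a = y i j := by
      intro i j
      apply hF.2
      · rw [← h₁, Matrix.mul_apply, Finset.mul_sum]
        simp_rw [← mul_assoc, Matrix.map_apply, hFF]
      · rw [← h₂, Matrix.mul_apply, Finset.sum_mul]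
        simp_rw [mul_assoc, Matrix.map_apply, hFF']
    choose z hz using hy
    obtain rfl : (Matrix.of z).map F = y := by ext1 i j; exact hz i j
    have hmul : ∀ u v : Matrix κ κ A, u.map F * v.map F = (u * v).map F := fun u v => by
      ext1 i j; simp [Matrix.mul_apply]
    rw [hmul] at h₁ h₂
    obtain ⟨a, ha⟩ := hG.2 _ (Matrix.map_injective hF.1 h₁) (Matrix.map_injective hF.1 h₂)
    exact ⟨a, by rw [compEmbedding_apply, ha]; rfl⟩

/-- If `w i ∈ M_ι(A)` satisfy `F 1 * w i = w i` and `∑ i, star (w i) * w i = e₁₁`, then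
`a ↦ F⁻¹(w i * (a ⊗ e₁₁) * star (w j))` is a corner embedding of `A` into `M_κ(A)`. -/
lemma IsCornerEmbedding.exists_inverse [DecidableEq ι] {F : A →⋆ₙₐ[ℂ] Matrix ι ι A}
    (hF : IsCornerEmbedding F) (b : ι) (w : κ → Matrix ι ι A) (hw : ∀ i, F 1 * w i = w i)
    (hwb : ∀ i, w i * Matrix.single b b 1 = w i)
    (hsum : ∑ i, star (w i) * w i = Matrix.single b b 1) :
    ∃ G : A →⋆ₙₐ[ℂ] Matrix κ κ A, IsCornerEmbedding G ∧
      ∀ i, F (G 1 i i) = w i * star (w i) := by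
  have hw' : ∀ i, star (w i) * F 1 = star (w i) := fun i => by
    rw [← star_one A, map_star, ← star_mul, hw]
  have star_single : ∀ a : A, star (Matrix.single b b a) = Matrix.single b b (star a) :=
    fun a => Matrix.conjTranspose_single b b a
  have hwb' : ∀ i, Matrix.single b b 1 * star (w i) = star (w i) := fun i => by
    rw [← star_one A, ← star_single, ← star_mul, hwb]
  have h : ∀ (a : A) (i j : κ), ∃ c, F c = w i * Matrix.single b b a * star (w j) := by
    intro a i j
    apply hF.2
    · rw [← mul_assoc, ← mul_assoc, hw]
    · rw [mul_assoc, hw']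
  choose g hg using h
  have hmid : ∀ x y : Matrix ι ι A,
      ∑ k, (x * star (w k)) * (w k * y) = x * Matrix.single b b 1 * y := fun x y => by
    rw [← hsum, Finset.mul_sum, Finset.sum_mul]
    exact Finset.sum_congr rfl fun k _ => by noncomm_ring
  let G : A →⋆ₙₐ[ℂ] Matrix κ κ A :=
    { toFun := fun a => Matrix.of (g a)
      map_smul' := fun c a => by
        ext i j
        apply hF.1
        simp [hg, ← Matrix.smul_single]
      map_zero' := by
        ext i j
        apply hF.1
        simp [hg]
      map_add' := fun a a' => by
        ext i j
        apply hF.1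
        simp [hg, Matrix.single_add, mul_add, add_mul]
      map_mul' := fun a a' => by
        ext i j
        apply hF.1
        simp only [Matrix.of_apply, Matrix.mul_apply, map_sum, map_mul, hg]
        simp_rw [mul_assoc (w _) (Matrix.single b b a') _, hmid]
        have hsingle : Matrix.single b b (a * a') =
            Matrix.single b b a * Matrix.single b b 1 * Matrix.single b b a' := by simp
        rw [hsingle]
        simp only [mul_assoc]
      map_star' := fun a => by
        ext i j
        apply hF.1
        rw [Matrix.of_apply, Matrix.star_apply, Matrix.of_apply, map_star, hg, hg]
        simp only [star_mul, star_star, star_single, mul_assoc] }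
  have hG : ∀ a i j, F (G a i j) = w i * Matrix.single b b a * star (w j) := hg
  have hG1 : ∀ i j, F (G 1 i j) = w i * star (w j) := fun i j => by rw [hG, hwb]
  refine ⟨G, ⟨fun a a' haa => ?_, fun x h₁ h₂ => ?_⟩, fun i => hG1 i i⟩
  · have key : ∀ a, ∑ i, ∑ j, star (w i) * F (G a i j) * w j = Matrix.single b b a := by
      intro a
      calc ∑ i, ∑ j, star (w i) * F (G a i j) * w j
          = (∑ i, star (w i) * w i) * Matrix.single b b a * ∑ j, star (w j) * w j := by
            simp_rw [Finset.sum_mul, Finset.mul_sum, hG, mul_assoc]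
        _ = _ := by simp [hsum]
    have := (key a).symm.trans ((by rw [haa] : _ = _).trans (key a'))
    simpa using congrFun₂ this b b
  · let y := ∑ k, ∑ l, star (w k) * F (x k l) * w l
    have hy : Matrix.single b b (y b b) = y := by
      have : Matrix.single b b 1 * y * Matrix.single b b 1 = y := by
        simp_rw [y, Finset.mul_sum, Finset.sum_mul, ← mul_assoc, hwb', mul_assoc, hwb]
      rw [← this, Matrix.single_mul_mul_single]
      simp
    refine ⟨y b b, ?_⟩
    ext i j
    apply hF.1
    have hx : G 1 * x * G 1 = x := by rw [h₁, h₂]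
    rw [hG, hy]
    conv_rhs => rw [← hx]
    simp only [y, Matrix.mul_apply, Finset.mul_sum, Finset.sum_mul, map_sum, map_mul, hG1]
    rw [Finset.sum_comm]
    simp only [mul_assoc]

end Embeddings

section Trace

variable {A : Type*} [CStarAlgebra A]

/-- In a simple unital C⋆-algebra every nonzero positive element `h` is full:
`1 = ∑ i, star (x i) * h * x i` for finitely many `x i`. -/
lemma exists_sum_star_mul_mul_eq_one [PartialOrder A] [StarOrderedRing A]
    (hsimple : ∀ I : TwoSidedIdeal A, IsClosed (I : Set A) → I = ⊥ ∨ I = ⊤)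
    {h : A} (hh : 0 ≤ h) (h0 : h ≠ 0) :
    ∃ (κ : Type) (_ : Fintype κ) (x : κ → A), ∑ i, star (x i) * h * x i = 1 := by
  let J : AddSubgroup A := AddSubgroup.closure (Set.range fun yz : A × A => yz.1 * h * yz.2)
  have hJ : ∀ y z : A, y * h * z ∈ J := fun y z => AddSubgroup.subset_closure ⟨(y, z), rfl⟩
  have hleft : ∀ c x : A, x ∈ J → c * x ∈ J := by
    intro c x hx
    induction hx using AddSubgroup.closure_induction with
    | mem x hx =>
      obtain ⟨⟨y, z⟩, rfl⟩ := hx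
      simpa only [mul_assoc] using hJ (c * y) z
    | zero => simp
    | add x y _ _ hx hy => rw [mul_add]; exact add_mem hx hy
    | neg x _ hx => rw [mul_neg]; exact neg_mem hx
  have hright : ∀ c x : A, x ∈ J → x * c ∈ J := by
    intro c x hx
    induction hx using AddSubgroup.closure_induction with
    | mem x hx =>
      obtain ⟨⟨y, z⟩, rfl⟩ := hx
      simpa only [mul_assoc] using hJ y (z * c)
    | zero => simp
    | add x y _ _ hx hy => rw [add_mul]; exact add_mem hx hy
    | neg x _ hx => rw [neg_mul]; exact neg_mem hx
  let K : TwoSidedIdeal A := TwoSidedIdeal.mk' (J.topologicalClosure : Set A)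
    (zero_mem J.topologicalClosure) add_mem neg_mem
    (fun {c _} hx => map_mem_closure (continuous_const_mul c) hx (hleft c))
    (fun {x c} hx => map_mem_closure (f := (· * c)) (continuous_mul_const c) hx (hright c))
  have hK : (K : Set A) = J.topologicalClosure := TwoSidedIdeal.coe_mk' ..
  have hKtop : K = ⊤ := by
    refine (hsimple K (hK ▸ J.isClosed_topologicalClosure)).resolve_left fun hbot => h0 ?_
    have : h ∈ (K : Set A) := hK ▸ J.le_topologicalClosure (by simpa using hJ 1 1)
    rwa [hbot] at this
  have h1 : (1 : A) ∈ J := by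
    have h1c : (1 : A) ∈ closure (J : Set A) := by
      have : (1 : A) ∈ (K : Set A) := by rw [hKtop]; trivial
      rwa [hK] at this
    obtain ⟨u, hu, hdist⟩ := Metric.mem_closure_iff.1 h1c 1 one_pos
    rw [dist_eq_norm] at hdist
    have hu' : u = (Units.oneSub (1 - u) hdist : A) := by simp
    have := hleft (↑(Units.oneSub (1 - u) hdist)⁻¹) u hu
    rwa [(Units.inv_mul_eq_one).2 hu'.symm] at this
  have hbound : ∀ a ∈ J, ∃ (κ : Type) (_ : Fintype κ) (x : κ → A),
      a + star a ≤ ∑ i, star (x i) * h * x i := by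
    have hsa : star h = h := (IsSelfAdjoint.of_nonneg hh).star_eq
    have base : ∀ y z : A, ∃ (κ : Type) (_ : Fintype κ) (x : κ → A),
        y * h * z + star (y * h * z) ≤ ∑ i, star (x i) * h * x i := by
      intro y z
      refine ⟨Bool, inferInstance, fun i => if i then star y else z, ?_⟩
      have := star_left_conjugate_nonneg hh (star y - z)
      rw [← sub_nonneg]
      convert this using 1
      simp [hsa]
      noncomm_ring
    intro a ha
    induction ha using AddSubgroup.closure_induction'' with
    | zero => exact ⟨Empty, inferInstance, fun _ => 0, by simp⟩
    | mem x hx =>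
      obtain ⟨⟨y, z⟩, rfl⟩ := hx
      exact base y z
    | neg_mem x hx =>
      obtain ⟨⟨y, z⟩, rfl⟩ := hx
      simpa only [neg_mul] using base (-y) z
    | add a b _ _ ha hb =>
      obtain ⟨κ, _, x, hx⟩ := ha
      obtain ⟨κ', _, x', hx'⟩ := hb
      refine ⟨κ ⊕ κ', inferInstance, Sum.elim x x', ?_⟩
      simp only [Fintype.sum_sum_type, Sum.elim_inl, Sum.elim_inr, star_add]
      calc a + b + (star a + star b) = a + star a + (b + star b) := by abel
        _ ≤ _ := add_le_add hx hx'
  obtain ⟨κ, _, x, hx⟩ := hbound 1 h1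
  set S := ∑ i, star (x i) * h * x i with hS
  have hone : (1 : A) ≤ S :=
    le_trans (by simp) hx
  have hSpos : IsStrictlyPositive S := IsStrictlyPositive.of_le isStrictlyPositive_one hone
  have hr : star (S ^ (-(1 / 2) : ℝ)) = S ^ (-(1 / 2) : ℝ) :=
    (IsSelfAdjoint.of_nonneg CFC.rpow_nonneg).star_eq
  refine ⟨κ, inferInstance, fun i => x i * S ^ (-(1 / 2) : ℝ), ?_⟩
  rw [← CFC.conjugate_rpow_neg_one_half S hSpos]
  conv_rhs => rw [mul_assoc]; arg 2; arg 1; rw [hS]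
  simp only [star_mul, hr, Finset.mul_sum, Finset.sum_mul, mul_assoc]

lemma IsTracialState.pos_of_nonneg_of_ne_zero [PartialOrder A] [StarOrderedRing A]
    {τ : A →L[ℂ] ℂ} (hτ : IsTracialState τ)
    (hsimple : ∀ I : TwoSidedIdeal A, IsClosed (I : Set A) → I = ⊥ ∨ I = ⊤)
    {h : A} (hh : 0 ≤ h) (h0 : h ≠ 0) : 0 < τ h := by
  have hnonneg : ∀ a : A, 0 ≤ a → 0 ≤ τ a := fun a ha => by
    obtain ⟨c, rfl⟩ := CStarAlgebra.nonneg_iff_eq_star_mul_self.1 ha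
    exact hτ.1 c
  refine (hnonneg h hh).lt_of_ne' fun hzero => ?_
  obtain ⟨κ, _, x, hx⟩ := exists_sum_star_mul_mul_eq_one hsimple hh h0
  obtain ⟨c, rfl⟩ := CStarAlgebra.nonneg_iff_eq_star_mul_self.1 hh
  refine one_ne_zero (α := ℂ) ?_
  rw [← hτ.2.1, ← hx, map_sum]
  refine Finset.sum_eq_zero fun i _ => le_antisymm ?_ ?_
  · have hconj : τ (star (x i) * (star c * c) * x i) = τ (c * (x i * star (x i)) * star c) := by
      rw [hτ.2.2 _ (x i), hτ.2.2 _ (star c)]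
      rw [← mul_assoc, hτ.2.2]
      simp only [mul_assoc]
    have hle := CStarAlgebra.star_right_conjugate_le_norm_smul (a := c)
      (b := x i * star (x i)) (.mul_star_self _)
    have := hnonneg _ (sub_nonneg.2 hle)
    rw [map_sub, ← Complex.coe_smul, map_smul, hτ.2.2 c (star c), hzero, smul_zero,
      zero_sub] at this
    rw [hconj]
    exact neg_nonneg.1 this
  · exact hnonneg _ (star_left_conjugate_nonneg hh _)

variable {ι : Type*} [Fintype ι]

lemma IsTracialState.trace_mul_comm {τ : A →L[ℂ] ℂ} (hτ : IsTracialState τ)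
    (x y : Matrix ι ι A) : ∑ i, τ ((x * y) i i) = ∑ i, τ ((y * x) i i) := by
  simp_rw [Matrix.mul_apply, map_sum]
  rw [Finset.sum_comm]
  simp_rw [hτ.2.2]

lemma exists_diag_ne_zero [PartialOrder A] [StarOrderedRing A] {p : Matrix ι ι A}
    (hp : star p * p = p) (h0 : p ≠ 0) : ∃ b, p b b ≠ 0 := by
  by_contra! hdiag
  refine h0 (Matrix.ext fun i b => ?_)
  have := hdiag b
  rw [← hp, Matrix.mul_apply] at this
  simp only [Matrix.star_apply] at this
  rw [Finset.sum_eq_zero_iff_of_nonneg fun j _ => star_mul_self_nonneg (p j b)] at this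
  exact CStarRing.star_mul_self_eq_zero_iff _ |>.1 (this i (Finset.mem_univ i))

lemma diag_star_mul_self_nonneg [PartialOrder A] [StarOrderedRing A] (x : Matrix ι ι A) (b : ι) :
    0 ≤ (star x * x) b b := by
  rw [Matrix.mul_apply]
  exact Finset.sum_nonneg fun j _ => star_mul_self_nonneg (x j b)

lemma IsTracialState.trace_pos {τ : A →L[ℂ] ℂ} (hτ : IsTracialState τ)
    (hsimple : ∀ I : TwoSidedIdeal A, IsClosed (I : Set A) → I = ⊥ ∨ I = ⊤)
    {p : Matrix ι ι A} (hp : star p * p = p) (h0 : p ≠ 0) : 0 < ∑ i, τ (p i i) := by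
  let _ := CStarAlgebra.spectralOrder A
  have := CStarAlgebra.spectralOrderedRing A
  have hdiag : ∀ b, 0 ≤ p b b := fun b => hp ▸ diag_star_mul_self_nonneg p b
  obtain ⟨b, hb⟩ := exists_diag_ne_zero hp h0
  refine Finset.sum_pos' (fun i _ => ?_) ⟨b, Finset.mem_univ b,
    hτ.pos_of_nonneg_of_ne_zero hsimple (hdiag b) hb⟩
  by_cases hi : p i i = 0
  · simp [hi]
  · exact (hτ.pos_of_nonneg_of_ne_zero hsimple (hdiag i) hi).le

/-- A *-homomorphism into a matrix algebra multiplies the unique trace by a constant. -/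
lemma IsTracialState.trace_map {τ : A →L[ℂ] ℂ} (hτ : IsTracialState τ)
    (huniq : ∀ σ : A →L[ℂ] ℂ, IsTracialState σ → σ = τ) (F : A →⋆ₙₐ[ℂ] Matrix ι ι A)
    (hF : 0 < ∑ i, τ (F 1 i i)) (a : A) :
    ∑ i, τ (F a i i) = (∑ i, τ (F 1 i i)) * τ a := by
  let _ := CStarAlgebra.spectralOrder A
  have := CStarAlgebra.spectralOrderedRing A
  set T : ℂ := ∑ i, τ (F 1 i i) with hT
  let f : A →ₗ[ℂ] ℂ :=
    { toFun := fun a => T⁻¹ * ∑ i, τ (F a i i)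
      map_add' := fun a b => by simp [Finset.sum_add_distrib, mul_add]
      map_smul' := fun c a => by
        simp only [map_smul, Matrix.smul_apply, smul_eq_mul, ← Finset.mul_sum, RingHom.id_apply]
        ring }
  have hf : ∀ a, f a = T⁻¹ * ∑ i, τ (F a i i) := fun _ => rfl
  have hpos : ∀ a, 0 ≤ f (star a * a) := fun a => by
    rw [hf, map_mul, map_star]
    refine mul_nonneg (inv_nonneg.2 hF.le) (Finset.sum_nonneg fun i _ => ?_)
    rw [Matrix.mul_apply, map_sum]
    exact Finset.sum_nonneg fun j _ => hτ.1 _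
  let f' : A →ₚ[ℂ] ℂ := PositiveLinearMap.mk₀ f fun a ha => by
    obtain ⟨c, rfl⟩ := CStarAlgebra.nonneg_iff_eq_star_mul_self.1 ha
    exact hpos c
  let σ : A →L[ℂ] ℂ := ⟨f, map_continuous f'⟩
  have hσ : σ = τ := huniq σ ⟨hpos, inv_mul_cancel₀ hF.ne', fun a b => by
    change f _ = f _
    rw [hf, hf, map_mul, map_mul, hτ.trace_mul_comm]⟩
  have hσa : τ a = f a := by rw [← hσ]; rfl
  rw [hσa, hf]
  rw [mul_inv_cancel_left₀ hF.ne']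

end Trace

/-- Let `A` be a simple unital C*-algebra with a unique tracial state `τ`. Then the fundamental
group `𝓕(A)` is a subgroup of the multiplicative group of positive reals: every element is
strictly positive, `1 ∈ 𝓕(A)`, and `𝓕(A)` is closed under multiplication and inverses. -/
theorem fundGroup_isSubgroup {A : Type*} [CStarAlgebra A] [Nontrivial A]
    (hsimple : ∀ I : TwoSidedIdeal A, IsClosed (I : Set A) → I = ⊥ ∨ I = ⊤)
    (τ : A →L[ℂ] ℂ) (hτ : IsTracialState τ)
    (huniq : ∀ σ : A →L[ℂ] ℂ, IsTracialState σ → σ = τ) :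
    (∀ t ∈ fundGroup A τ, 0 < t) ∧ (1 : ℝ) ∈ fundGroup A τ ∧
    (∀ s t : ℝ, s ∈ fundGroup A τ → t ∈ fundGroup A τ → s * t ∈ fundGroup A τ) ∧
    (∀ t ∈ fundGroup A τ, t⁻¹ ∈ fundGroup A τ) := by
  have hproj : ∀ {n : ℕ} (F : A →⋆ₙₐ[ℂ] Matrix (Fin n) (Fin n) A), star (F 1) * F 1 = F 1 :=
    fun F => by rw [← map_star, ← map_mul, star_one, mul_one]
  have hne : ∀ {n : ℕ} {F : A →⋆ₙₐ[ℂ] Matrix (Fin n) (Fin n) A}, IsCornerEmbedding F → F 1 ≠ 0 :=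
    fun hF => (map_ne_zero_iff _ hF.1).2 one_ne_zero
  have htrace : ∀ {n : ℕ} {F : A →⋆ₙₐ[ℂ] Matrix (Fin n) (Fin n) A}, IsCornerEmbedding F →
      0 < ∑ i, τ (F 1 i i) := fun {_ F} hF => hτ.trace_pos hsimple (hproj F) (hne hF)
  refine ⟨fun t ht => ?_, ?_, fun s t hs ht => ?_, fun t ht => ?_⟩
  · obtain ⟨n, F, hF, rfl⟩ := exists_isCornerEmbedding ht
    exact (Complex.pos_iff.1 (htrace hF)).1
  · let F : A →⋆ₙₐ[ℂ] Matrix Unit Unit A :=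
      { toFun := fun a => Matrix.of fun _ _ => a
        map_smul' := fun c a => rfl
        map_zero' := rfl
        map_add' := fun a b => rfl
        map_mul' := fun a b => by ext; simp [Matrix.mul_apply]
        map_star' := fun a => rfl }
    have hF : IsCornerEmbedding F :=
      ⟨fun a b h => congrFun₂ h () (), fun x _ _ => ⟨x () (), rfl⟩⟩
    have := mem_fundGroup_of_isCornerEmbedding τ hF
    have hF1 : ∀ i, F 1 i i = 1 := fun _ => rfl
    simpa [hF1, hτ.2.1] using this
  · obtain ⟨m, F, hF, rfl⟩ := exists_isCornerEmbedding hs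
    obtain ⟨n, G, hG, rfl⟩ := exists_isCornerEmbedding ht
    have hcomp : ∑ i, τ (compEmbedding F G 1 i i) =
        (∑ i, τ (F 1 i i)) * ∑ i, τ (G 1 i i) := by
      rw [Fintype.sum_prod_type, Finset.mul_sum]
      exact Finset.sum_congr rfl fun i _ => hτ.trace_map huniq F (htrace hF) (G 1 i i)
    have := mem_fundGroup_of_isCornerEmbedding τ (hF.comp hG)
    rwa [hcomp, Complex.mul_re, ← (Complex.pos_iff.1 (htrace hF)).2, zero_mul, sub_zero] at this
  · obtain ⟨n, F, hF, rfl⟩ := exists_isCornerEmbedding ht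
    let _ := CStarAlgebra.spectralOrder A
    have := CStarAlgebra.spectralOrderedRing A
    obtain ⟨b, hb⟩ := exists_diag_ne_zero (hproj F) (hne hF)
    obtain ⟨κ, _, x, hx⟩ := exists_sum_star_mul_mul_eq_one hsimple
      (hproj F ▸ diag_star_mul_self_nonneg (F 1) b) hb
    have hsum : ∑ i, star (F 1 * Matrix.single b b (x i)) * (F 1 * Matrix.single b b (x i)) =
        Matrix.single b b 1 := by
      have hterm : ∀ i, star (F 1 * Matrix.single b b (x i)) * (F 1 * Matrix.single b b (x i)) =
          Matrix.single b b (star (x i) * F 1 b b * x i) := fun i => by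
        rw [star_mul, mul_assoc, ← mul_assoc (star (F 1)), hproj, ← mul_assoc,
          Matrix.star_eq_conjTranspose, Matrix.conjTranspose_single,
          Matrix.single_mul_mul_single]
      simp_rw [hterm]
      refine Eq.trans ?_ (congrArg (Matrix.single b b) hx)
      exact (map_sum (Matrix.singleAddMonoidHom (α := A) b b) _ _).symm
    obtain ⟨G, hG, hGF⟩ := hF.exists_inverse b (fun i => F 1 * Matrix.single b b (x i))
      (fun i => by rw [← mul_assoc, ← map_mul, one_mul])
      (fun i => by simp [mul_assoc]) hsum
    have hprod : (∑ i, τ (F 1 i i)) * ∑ i, τ (G 1 i i) = 1 := by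
      rw [Finset.mul_sum]
      simp only [← hτ.trace_map huniq F (htrace hF), hGF]
      simp_rw [hτ.trace_mul_comm (F 1 * _)]
      rw [Finset.sum_comm]
      simp_rw [← map_sum, ← Matrix.sum_apply, hsum]
      simp [Matrix.single_apply, hτ.2.1]
    have := mem_fundGroup_of_isCornerEmbedding τ hG
    rwa [eq_inv_of_mul_eq_one_right hprod,
      (Complex.ext rfl (Complex.pos_iff.1 (htrace hF)).2.symm :
        ∑ i, τ (F 1 i i) = ((∑ i, τ (F 1 i i)).re : ℂ)),
      ← Complex.ofReal_inv, Complex.ofReal_re] at this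
end

section
/- Let A be a separable simple unital C*-algebra with a unique tracial state τ. Then the fundamental group 𝓕(A) = { (τ⊗Tr)(p) : n ∈ ℕ, p a projection in M_n(A) such that pM_n(A)p is *-isomorphic to A } is a countable set. -/
open scoped ComplexOrder

/-- The functional `τ ⊗ Tr` is tracial on matrices whenever `τ` is tracial. -/
theorem sum_apply_diag_mul_comm {R M F ι : Type*} [Fintype ι] [NonUnitalNonAssocSemiring R]
    [AddCommMonoid M] [FunLike F R M] [AddMonoidHomClass F R M] (τ : F)
    (hτ : ∀ a b : R, τ (a * b) = τ (b * a)) (x y : Matrix ι ι R) :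
    ∑ i, τ ((x * y) i i) = ∑ i, τ ((y * x) i i) := by
  simp only [Matrix.mul_apply, map_sum]
  rw [Finset.sum_comm]
  simp only [hτ]

/-- Idempotents `p` and `q` are intertwined by `p * q + (1 - p) * (1 - q)`. -/
theorem IsIdempotentElem.exists_units_eq_conj {R : Type*} [Ring R] {p q : R}
    (hp : IsIdempotentElem p) (hq : IsIdempotentElem q)
    (h : IsUnit (p * q + (1 - p) * (1 - q))) : ∃ u : Rˣ, p = u * q * ↑u⁻¹ := by
  obtain ⟨u, hu⟩ := h
  refine ⟨u, (Units.eq_mul_inv_iff_mul_eq u).2 ?_⟩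
  have hp' : p * (1 - p) = 0 := by rw [mul_sub, mul_one, hp.eq, sub_self]
  have hq' : (1 - q) * q = 0 := by rw [sub_mul, one_mul, hq.eq, sub_self]
  rw [hu, mul_add, add_mul, ← mul_assoc, ← mul_assoc, hp.eq, hp', mul_assoc p q q, hq.eq,
    mul_assoc (1 - p), hq']
  simp

theorem Matrix.isOpen_setOf_isUnit {R ι : Type*} [NormedRing R] [CompleteSpace R] [Fintype ι]
    [DecidableEq ι] : IsOpen {x : Matrix ι ι R | IsUnit x} := by
  let : NormedRing (Matrix ι ι R) := Matrix.linftyOpNormedRing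
  have : @CompleteSpace (Matrix ι ι R) PseudoMetricSpace.toUniformSpace :=
    inferInstanceAs (CompleteSpace (ι → ι → R))
  exact Units.isOpen

/-- A tracial functional takes only countably many values on the idempotent matrices over a
separable Banach algebra. -/
theorem countable_image_sum_apply_diag {R M F ι : Type*} [NormedRing R] [CompleteSpace R]
    [TopologicalSpace.SeparableSpace R] [AddCommMonoid M] [FunLike F R M]
    [AddMonoidHomClass F R M] [Fintype ι] (τ : F) (hτ : ∀ a b : R, τ (a * b) = τ (b * a)) :
    ((fun p : Matrix ι ι R => ∑ i, τ (p i i)) '' {p | IsIdempotentElem p}).Countable := by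
  classical
  have : SecondCountableTopology R := UniformSpace.secondCountable_of_separable R
  have : SecondCountableTopology (Matrix ι ι R) :=
    inferInstanceAs (SecondCountableTopology (ι → ι → R))
  have hU (p : Matrix ι ι R) (hp : IsIdempotentElem p) :
      {q : Matrix ι ι R | IsUnit (p * q + (1 - p) * (1 - q))} ∈ nhds p := by
    refine (Matrix.isOpen_setOf_isUnit.preimage (by fun_prop)).mem_nhds ?_
    simp [hp.eq, hp.one_sub.eq]
  obtain ⟨s, hs, hsc, hcover⟩ := TopologicalSpace.countable_cover_nhdsWithin
    (s := {p : Matrix ι ι R | IsIdempotentElem p})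
    fun p hp => mem_nhdsWithin_of_mem_nhds (hU p hp)
  refine (hsc.image fun p : Matrix ι ι R => ∑ i, τ (p i i)).mono ?_
  rintro _ ⟨q, hq, rfl⟩
  obtain ⟨p, hps, hpq⟩ := Set.mem_iUnion₂.1 (hcover hq)
  obtain ⟨u, rfl⟩ := IsIdempotentElem.exists_units_eq_conj (hs hps) hq hpq
  refine ⟨_, hps, ?_⟩
  dsimp only
  rw [sum_apply_diag_mul_comm τ hτ, Units.inv_mul_cancel_left]

/-- Let `A` be a separable simple unital C*-algebra with a unique tracial state `τ`. Then the
fundamental group `𝓕(A)` is a countable set. -/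
theorem fundGroup_countable {A : Type*} [CStarAlgebra A] [Nontrivial A]
    [TopologicalSpace.SeparableSpace A]
    (hsimple : ∀ I : TwoSidedIdeal A, IsClosed (I : Set A) → I = ⊥ ∨ I = ⊤)
    (τ : A →L[ℂ] ℂ) (hτ : IsTracialState τ)
    (huniq : ∀ σ : A →L[ℂ] ℂ, IsTracialState σ → σ = τ) :
    (fundGroup A τ).Countable := by
  refine (Set.countable_iUnion fun n : ℕ =>
    (countable_image_sum_apply_diag (ι := Fin n) τ hτ.2.2).image Complex.re).mono ?_
  rintro _ ⟨n, p, hp, -, -, rfl⟩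
  exact Set.mem_iUnion.2 ⟨n, _, ⟨p, hp, rfl⟩, rfl⟩
end

section
/- Let A be a simple unital C*-algebra with a unique tracial state τ, let p be a nonzero projection in M_n(A), and let B = pM_n(A)p be the corresponding corner C*-algebra. Then B is a simple unital C*-algebra with a unique tracial state, and 𝓕(B) = 𝓕(A), where for a simple unital C*-algebra C with unique tracial state σ we set 𝓕(C) = { (σ⊗Tr)(r) : k ∈ ℕ, r a projection in M_k(C) such that rM_k(C)r is *-isomorphic to C }. -/
open scoped ComplexOrder

theorem IsSimpleRing.exists_sum_mul_mul_eq_one {R : Type*} [Ring R] [IsSimpleRing R] {a : R}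
    (ha : a ≠ 0) : ∃ (m : ℕ) (x y : Fin m → R), ∑ i, x i * a * y i = 1 := by
  have h1 : (1 : R) ∈ TwoSidedIdeal.span {a} :=
    IsSimpleRing.one_mem_of_ne_zero_mem _ ha (TwoSidedIdeal.subset_span rfl)
  rw [TwoSidedIdeal.mem_span_iff_mem_addSubgroup_closure] at h1
  generalize (1 : R) = e at h1 ⊢
  induction h1 using AddSubgroup.closure_induction with
  | mem z hz =>
    obtain ⟨_, ⟨x, -, _, rfl, rfl⟩, y, -, rfl⟩ := hz
    exact ⟨1, fun _ => x, fun _ => y, by simp⟩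
  | zero => exact ⟨0, 0, 0, by simp⟩
  | add z w _ _ hz hw =>
    obtain ⟨m, x, y, rfl⟩ := hz
    obtain ⟨k, x', y', rfl⟩ := hw
    exact ⟨m + k, Fin.append x x', Fin.append y y', by simp [Fin.sum_univ_add]⟩
  | neg z _ hz =>
    obtain ⟨m, x, y, rfl⟩ := hz
    exact ⟨m, -x, y, by simp⟩

theorem isSimpleRing_of_isClosed {A : Type*} [CStarAlgebra A] [Nontrivial A]
    (h : ∀ I : TwoSidedIdeal A, IsClosed (I : Set A) → I = ⊥ ∨ I = ⊤) : IsSimpleRing A := by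
  refine ⟨⟨fun I => ?_⟩⟩
  let J : TwoSidedIdeal A := .mk' (closure (I : Set A)) (subset_closure I.zero_mem)
    (fun hx hy => map_mem_closure₂ continuous_add hx hy fun _ ha _ hb => I.add_mem ha hb)
    (fun hx => map_mem_closure continuous_neg hx fun _ ha => I.neg_mem ha)
    (fun {x y} hy => map_mem_closure (continuous_const_mul x) hy fun _ ha =>
      I.mul_mem_left _ _ ha)
    (fun {x y} hx => map_mem_closure (f := (· * y)) (continuous_mul_const y) hx fun _ ha =>
      I.mul_mem_right _ _ ha)
  have hJ : (J : Set A) = closure (I : Set A) := TwoSidedIdeal.coe_mk' ..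
  rcases h J (hJ ▸ isClosed_closure) with hb | ht
  · left
    rw [eq_bot_iff]
    intro x hx
    rw [← hb, ← SetLike.mem_coe, hJ]
    exact subset_closure hx
  · right
    have h1 : (1 : A) ∈ closure (I : Set A) := by
      rw [← hJ, ht]; trivial
    obtain ⟨u, hu, huI⟩ := mem_closure_iff.mp h1 _ Units.isOpen isUnit_one
    obtain ⟨u, rfl⟩ := hu
    rw [← TwoSidedIdeal.one_mem_iff]
    simpa using I.mul_mem_left (↑u⁻¹) _ huI

theorem CStarAlgebra.exists_sum_star_mul_mul_eq_one {A : Type*} [CStarAlgebra A] [PartialOrder A]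
    [StarOrderedRing A] [IsSimpleRing A] {h : A} (hh : 0 ≤ h) (hne : h ≠ 0) :
    ∃ (m : ℕ) (c : Fin m → A), ∑ i, star (c i) * h * c i = 1 := by
  obtain ⟨m, a, b, hab⟩ := IsSimpleRing.exists_sum_mul_mul_eq_one hne
  have hsa : star h = h := (IsSelfAdjoint.of_nonneg hh).star_eq
  have hab' : ∑ i, star (b i) * h * star (a i) = 1 := by
    simpa [hsa, mul_assoc] using congrArg star hab
  let c := Fin.append (fun i => star (a i)) b
  let S := ∑ i, star (c i) * h * c i
  have hS : (1 : A) ≤ S := by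
    have h0 : 0 ≤ ∑ i, star (star (a i) - b i) * h * (star (a i) - b i) :=
      Finset.sum_nonneg fun i _ => star_left_conjugate_nonneg hh _
    have h1 : ∑ i, star (star (a i) - b i) * h * (star (a i) - b i) = S - 1 - 1 := by
      simp only [S, c, Fin.sum_univ_add, Fin.append_left, Fin.append_right]
      nth_rewrite 1 [← hab]
      rw [← hab', ← Finset.sum_add_distrib, ← Finset.sum_sub_distrib, ← Finset.sum_sub_distrib]
      refine Finset.sum_congr rfl fun i _ => ?_
      simp only [star_sub, star_star]
      noncomm_ring
    rw [h1, sub_sub, sub_nonneg] at h0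
    exact le_trans (le_add_of_nonneg_left zero_le_one) h0
  have hS0 : 0 ≤ S := zero_le_one.trans hS
  have hu : IsUnit (CFC.sqrt S) :=
    (CFC.isUnit_sqrt_iff S).mpr (CStarAlgebra.isUnit_of_le 1 hS)
  obtain ⟨u, hu⟩ := hu
  have hus : star (u : A) = u := by
    rw [hu]; exact (IsSelfAdjoint.of_nonneg (CFC.sqrt_nonneg S)).star_eq
  have hui : star (↑u⁻¹ : A) = ↑u⁻¹ := by
    rw [← Units.coe_star_inv]
    exact congrArg (fun v : Aˣ => (↑v⁻¹ : A)) (Units.ext hus)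
  have huS : (u : A) * u = S := by rw [hu]; exact CFC.sqrt_mul_sqrt_self S
  refine ⟨m + m, fun i => c i * ↑u⁻¹, ?_⟩
  calc ∑ i, star (c i * ↑u⁻¹) * h * (c i * ↑u⁻¹) = ↑u⁻¹ * S * ↑u⁻¹ := by
        simp only [S, Finset.mul_sum, Finset.sum_mul, star_mul, hui, mul_assoc]
    _ = 1 := by rw [← huS]; simp

/-- A tracial positive linear functional, not necessarily normalized or a priori continuous. -/
structure IsPosTrace {A : Type*} [NonUnitalRing A] [StarRing A] [Module ℂ A]
    (ρ : A →ₗ[ℂ] ℂ) : Prop where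
  nonneg (a : A) : 0 ≤ ρ (star a * a)
  comm (a b : A) : ρ (a * b) = ρ (b * a)

theorem IsPosTrace.continuous {A : Type*} [CStarAlgebra A] {ρ : A →ₗ[ℂ] ℂ} (h : IsPosTrace ρ) :
    Continuous ρ := by
  let _ := CStarAlgebra.spectralOrder A
  have _ := CStarAlgebra.spectralOrderedRing A
  let f : A →ₚ[ℂ] ℂ := .mk₀ ρ fun x hx => by
    obtain ⟨s, rfl⟩ := CStarAlgebra.nonneg_iff_eq_star_mul_self.mp hx
    exact h.nonneg s
  exact map_continuous f

theorem IsTracialState.isPosTrace {A : Type*} [CStarAlgebra A] {τ : A →L[ℂ] ℂ}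
    (hτ : IsTracialState τ) : IsPosTrace (τ : A →ₗ[ℂ] ℂ) :=
  ⟨hτ.1, hτ.2.2⟩

theorem IsPosTrace.exists_isTracialState {A : Type*} [CStarAlgebra A] {ρ : A →ₗ[ℂ] ℂ}
    (h : IsPosTrace ρ) (h1 : ρ 1 ≠ 0) :
    ∃ σ : A →L[ℂ] ℂ, IsTracialState σ ∧ ∀ a, σ a = (ρ 1)⁻¹ * ρ a := by
  have h1' : 0 ≤ ρ 1 := by simpa using h.nonneg 1
  refine ⟨(ρ 1)⁻¹ • ⟨ρ, h.continuous⟩, ⟨fun a => ?_, ?_, fun a b => ?_⟩, fun a => rfl⟩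
  · exact mul_nonneg (inv_nonneg.mpr h1') (h.nonneg a)
  · exact inv_mul_cancel₀ h1
  · exact congrArg ((ρ 1)⁻¹ * ·) (h.comm a b)

theorem IsPosTrace.eq_mul {A : Type*} [CStarAlgebra A] {τ : A →L[ℂ] ℂ} (hτ : IsTracialState τ)
    (huniq : ∀ σ : A →L[ℂ] ℂ, IsTracialState σ → σ = τ) {ρ : A →ₗ[ℂ] ℂ} (h : IsPosTrace ρ)
    (a : A) : ρ a = ρ 1 * τ a := by
  have h1' : 0 ≤ ρ 1 := by simpa using h.nonneg 1
  have hpos : 0 < ρ 1 + τ 1 := by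
    rw [hτ.2.1]; exact add_pos_of_nonneg_of_pos h1' zero_lt_one
  have hsum : IsPosTrace (ρ + (τ : A →ₗ[ℂ] ℂ)) :=
    ⟨fun a => add_nonneg (h.nonneg a) (hτ.1 a), fun a b =>
      congrArg₂ (· + ·) (h.comm a b) (hτ.2.2 a b)⟩
  obtain ⟨σ, hσ, hσa⟩ := hsum.exists_isTracialState hpos.ne'
  have h2 := hσa a
  rw [huniq σ hσ] at h2
  simp only [LinearMap.add_apply, ContinuousLinearMap.coe_coe, hτ.2.1] at h2 hpos
  have h3 := hpos.ne'
  field_simp at h2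
  linear_combination -h2

theorem IsTracialState.eq_zero_of_apply_star_mul_self {A : Type*} [CStarAlgebra A] [IsSimpleRing A]
    {τ : A →L[ℂ] ℂ} (hτ : IsTracialState τ) {a : A} (ha : τ (star a * a) = 0) : a = 0 := by
  have key (b : A) : τ (b * a) = 0 := by
    have hexp (t : ℂ) : 0 ≤ τ (b * star b) + t * τ (b * a) + star t * τ (star a * star b) := by
      have := hτ.1 (star b + t • a)
      simpa [add_mul, mul_add, ha, add_assoc, add_comm, add_left_comm] using this
    have slope {c r : ℝ} (h : ∀ s : ℝ, 0 ≤ c + s * r) : r = 0 := by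
      by_contra hr
      have := h (-(c + 1) / r)
      rw [div_mul_cancel₀ _ hr] at this
      linarith
    have hre := slope (c := (τ (b * star b)).re) (r := (τ (b * a)).re + (τ (star a * star b)).re)
      fun s => by simpa [mul_add, add_assoc] using (Complex.nonneg_iff.mp (hexp s)).1
    have him := slope (c := (τ (b * star b)).re) (r := (τ (star a * star b)).im - (τ (b * a)).im)
      fun s => by
        have := (Complex.nonneg_iff.mp (hexp (s * Complex.I))).1
        simp at this
        linarith
    have h0 := (Complex.nonneg_iff.mp (hexp 0)).2
    have h1 := (Complex.nonneg_iff.mp (hexp 1)).2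
    have hI := (Complex.nonneg_iff.mp (hexp Complex.I)).2
    simp at h0 h1 hI
    apply Complex.ext <;> simp <;> linarith
  let N : TwoSidedIdeal A := .mk' {a | ∀ b, τ (b * a) = 0} (by simp)
    (fun hx hy b => by rw [mul_add, map_add, hx, hy, add_zero])
    (fun hx b => by rw [mul_neg, map_neg, hx, neg_zero])
    (fun hy b => by rw [← mul_assoc, hy])
    (fun {x y} hx b => by rw [← mul_assoc, hτ.2.2, ← mul_assoc, hx])
  by_contra hne
  have h1 : (1 : A) ∈ N := IsSimpleRing.one_mem_of_ne_zero_mem N hne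
    ((TwoSidedIdeal.mem_mk' ..).mpr key)
  have h2 := (TwoSidedIdeal.mem_mk' ..).mp h1 1
  rw [mul_one, hτ.2.1] at h2
  exact one_ne_zero h2

open Matrix in
theorem IsPosTrace.comp_trace {D ι : Type*} [CStarAlgebra D] [Fintype ι] {ρ : D →ₗ[ℂ] ℂ}
    (h : IsPosTrace ρ) : IsPosTrace (ρ ∘ₗ traceLinearMap ι ℂ D) where
  nonneg x := by
    simp only [LinearMap.comp_apply, traceLinearMap_apply, trace, diag_apply, mul_apply,
      star_apply, map_sum]
    exact Finset.sum_nonneg fun i _ => Finset.sum_nonneg fun j _ => h.nonneg _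
  comm x y := by
    simp only [LinearMap.comp_apply, traceLinearMap_apply, trace, diag_apply, mul_apply, map_sum]
    rw [Finset.sum_comm]
    simp only [h.comm]

theorem IsPosTrace.comp_hom {C E : Type*} [NonUnitalRing C] [StarRing C] [Module ℂ C]
    [NonUnitalRing E] [StarRing E] [Module ℂ E] {ρ : C →ₗ[ℂ] ℂ} (h : IsPosTrace ρ)
    (f : E →⋆ₙₐ[ℂ] C) : IsPosTrace (ρ ∘ₗ (f : E →ₗ[ℂ] C)) where
  nonneg x := by simpa [map_star] using h.nonneg (f x)
  comm x y := by simpa using h.comm (f x) (f y)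

/-- An injective star homomorphism from a unital algebra onto the corner cut out by the image
of the unit. -/
structure IsCornerEmbedding_s10 {E M : Type*} [Ring E] [StarRing E] [Module ℂ E] [Ring M] [StarRing M]
    [Module ℂ M] (f : E →⋆ₙₐ[ℂ] M) : Prop where
  injective : Function.Injective f
  exists_eq (y : M) : f 1 * y = y → y * f 1 = y → ∃ x, f x = y

section

variable {C D E : Type*} [CStarAlgebra C] [CStarAlgebra D] [CStarAlgebra E]

theorem exists_isCornerEmbedding_s10 {m : ℕ} {q : Matrix (Fin m) (Fin m) D} {hq : q * q = q}
    {hqs : star q = q} (φ : E ≃⋆ₐ[ℂ] corner q hq hqs) :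
    ∃ f : E →⋆ₙₐ[ℂ] Matrix (Fin m) (Fin m) D, IsCornerEmbedding_s10 f ∧ f 1 = q := by
  let f : E →⋆ₙₐ[ℂ] Matrix (Fin m) (Fin m) D :=
    { toFun := fun x => φ x
      map_smul' := fun c x => congrArg Subtype.val (map_smul φ c x)
      map_zero' := congrArg Subtype.val (map_zero φ)
      map_add' := fun x y => congrArg Subtype.val (map_add φ x y)
      map_mul' := fun x y => congrArg Subtype.val (map_mul φ x y)
      map_star' := fun x => congrArg Subtype.val (map_star φ x) }
  have hf (y) (h1 : q * y = y) (h2 : y * q = y) : ∃ x, f x = y :=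
    ⟨φ.symm ⟨y, h1, h2⟩, congrArg Subtype.val (φ.apply_symm_apply _)⟩
  have hf1 : f 1 = q := by
    obtain ⟨e, he⟩ := hf q hq hq
    calc f 1 = f 1 * q := (φ 1).2.2.symm
      _ = q := by rw [← he, ← map_mul, one_mul]
  exact ⟨f, ⟨fun x y h => φ.injective (Subtype.ext h), by rwa [hf1]⟩, hf1⟩

theorem IsCornerEmbedding_s10.nonempty_equiv {m : ℕ} {f : E →⋆ₙₐ[ℂ] Matrix (Fin m) (Fin m) D}
    (hf : IsCornerEmbedding_s10 f) (hq : f 1 * f 1 = f 1) (hqs : star (f 1) = f 1) :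
    Nonempty (corner (f 1) hq hqs ≃⋆ₐ[ℂ] E) := by
  let φ : E →⋆ₙₐ[ℂ] corner (f 1) hq hqs :=
    { toFun := fun x => ⟨f x, by rw [← map_mul, one_mul], by rw [← map_mul, mul_one]⟩
      map_smul' := fun c x => Subtype.ext (map_smul f c x)
      map_zero' := Subtype.ext (map_zero f)
      map_add' := fun x y => Subtype.ext (map_add f x y)
      map_mul' := fun x y => Subtype.ext (map_mul f x y)
      map_star' := fun x => Subtype.ext (map_star f x) }
  have hφ : Function.Bijective φ :=
    ⟨fun x y h => hf.injective (congrArg Subtype.val h), fun y => by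
      obtain ⟨x, hx⟩ := hf.exists_eq y y.2.1 y.2.2
      exact ⟨x, Subtype.ext hx⟩⟩
  exact ⟨(StarAlgEquiv.ofBijective φ hφ).symm⟩

theorem mem_fundGroup_iff {τ : D →L[ℂ] ℂ} {t : ℝ} :
    t ∈ fundGroup D τ ↔ ∃ (k : ℕ) (f : D →⋆ₙₐ[ℂ] Matrix (Fin k) (Fin k) D),
      IsCornerEmbedding_s10 f ∧ t = (τ (f 1).trace).re := by
  constructor
  · rintro ⟨k, p, hp, hps, ⟨φ⟩, rfl⟩
    obtain ⟨f, hf, rfl⟩ := exists_isCornerEmbedding_s10 φ.symm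
    exact ⟨k, f, hf, by simp [Matrix.trace]⟩
  · rintro ⟨k, f, hf, rfl⟩
    have hq : f 1 * f 1 = f 1 := by rw [← map_mul, one_mul]
    have hqs : star (f 1) = f 1 := by rw [← map_star, star_one]
    exact ⟨k, f 1, hq, hqs, hf.nonempty_equiv hq hqs, by simp [Matrix.trace]⟩

/-- Entrywise application of `f : C → M_m(D)`, as a map `M_N(C) → M_{Nm}(D)`. -/
noncomputable def amplify (N : ℕ) {m : ℕ} (f : C →⋆ₙₐ[ℂ] Matrix (Fin m) (Fin m) D) :
    Matrix (Fin N) (Fin N) C →⋆ₙₐ[ℂ] Matrix (Fin (N * m)) (Fin (N * m)) D where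
  toFun x := .of fun i j => f (x (finProdFinEquiv.symm i).1 (finProdFinEquiv.symm j).1)
    (finProdFinEquiv.symm i).2 (finProdFinEquiv.symm j).2
  map_smul' c x := by ext; simp
  map_zero' := by ext; simp
  map_add' x y := by ext; simp
  map_mul' x y := by
    ext i j
    simp only [Matrix.of_apply, Matrix.mul_apply, map_sum, map_mul, Matrix.sum_apply]
    rw [← finProdFinEquiv.sum_comp, Fintype.sum_prod_type]
    simp
  map_star' x := by ext; simp [Matrix.star_apply, map_star]

theorem amplify_apply {N m : ℕ} (f : C →⋆ₙₐ[ℂ] Matrix (Fin m) (Fin m) D)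
    (x : Matrix (Fin N) (Fin N) C) (i j : Fin N) (a b : Fin m) :
    amplify N f x (finProdFinEquiv (i, a)) (finProdFinEquiv (j, b)) = f (x i j) a b := by
  simp [amplify, -finProdFinEquiv_symm_apply]

theorem trace_amplify {N m : ℕ} (f : C →⋆ₙₐ[ℂ] Matrix (Fin m) (Fin m) D)
    (x : Matrix (Fin N) (Fin N) C) : (amplify N f x).trace = (f x.trace).trace := by
  simp only [Matrix.trace, Matrix.diag_apply, map_sum, Matrix.sum_apply]
  rw [← finProdFinEquiv.sum_comp, Fintype.sum_prod_type, Finset.sum_comm]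
  simp only [amplify_apply]

theorem amplify_injective {N m : ℕ} {f : C →⋆ₙₐ[ℂ] Matrix (Fin m) (Fin m) D}
    (hf : Function.Injective f) : Function.Injective (amplify N f) := by
  intro x y h
  ext i j
  refine hf ?_
  ext a b
  rw [← amplify_apply, h, amplify_apply]

theorem IsCornerEmbedding_s10.amplify_comp {N m : ℕ} {f : C →⋆ₙₐ[ℂ] Matrix (Fin m) (Fin m) D}
    (hf : IsCornerEmbedding_s10 f) {g : E →⋆ₙₐ[ℂ] Matrix (Fin N) (Fin N) C}
    (hg : IsCornerEmbedding_s10 g) : IsCornerEmbedding_s10 ((amplify N f).comp g) where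
  injective := (amplify_injective hf.injective).comp hg.injective
  exists_eq y h1 h2 := by
    let Y (i j : Fin N) : Matrix (Fin m) (Fin m) D :=
      .of fun a b => y (finProdFinEquiv (i, a)) (finProdFinEquiv (j, b))
    have hY1 (i j) : Y i j = ∑ k, f (g 1 i k) * Y k j := by
      ext a b
      simp only [Y, Matrix.sum_apply, Matrix.mul_apply, Matrix.of_apply]
      conv_lhs => rw [← h1]
      rw [Matrix.mul_apply, ← finProdFinEquiv.sum_comp, Fintype.sum_prod_type]
      simp only [NonUnitalStarAlgHom.comp_apply, amplify_apply]
    have hY2 (i j) : Y i j = ∑ k, Y i k * f (g 1 k j) := by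
      ext a b
      simp only [Y, Matrix.sum_apply, Matrix.mul_apply, Matrix.of_apply]
      conv_lhs => rw [← h2]
      rw [Matrix.mul_apply, ← finProdFinEquiv.sum_comp, Fintype.sum_prod_type]
      simp only [NonUnitalStarAlgHom.comp_apply, amplify_apply]
    have hex (i j) : ∃ c, f c = Y i j := by
      apply hf.exists_eq
      · rw [hY1, Finset.mul_sum]
        simp only [← mul_assoc, ← map_mul, one_mul]
      · rw [hY2, Finset.sum_mul]
        simp only [mul_assoc, ← map_mul, mul_one]
    choose x hx using hex
    have hxy : amplify N f (.of x) = y := by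
      ext i j
      obtain ⟨⟨i, a⟩, rfl⟩ := finProdFinEquiv.surjective i
      obtain ⟨⟨j, b⟩, rfl⟩ := finProdFinEquiv.surjective j
      rw [amplify_apply, Matrix.of_apply, hx]
      rfl
    obtain ⟨e, he⟩ := hg.exists_eq (.of x)
      (amplify_injective hf.injective (by rw [map_mul, hxy]; exact h1))
      (amplify_injective hf.injective (by rw [map_mul, hxy]; exact h2))
    exact ⟨e, by rw [NonUnitalStarAlgHom.comp_apply, he, hxy]⟩

theorem trace_apply_eq_mul {m : ℕ} {τ : C →L[ℂ] ℂ} (hτ : IsTracialState τ)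
    (huniq : ∀ σ : C →L[ℂ] ℂ, IsTracialState σ → σ = τ) {σ : D →L[ℂ] ℂ} (hσ : IsTracialState σ)
    (f : C →⋆ₙₐ[ℂ] Matrix (Fin m) (Fin m) D) (c : C) :
    σ (f c).trace = σ (f 1).trace * τ c :=
  (hσ.isPosTrace.comp_trace.comp_hom f).eq_mul hτ huniq c

theorem fundGroup_subset {n m : ℕ} {τ : C →L[ℂ] ℂ} {σ : D →L[ℂ] ℂ} (hτ : IsTracialState τ)
    (hτu : ∀ σ : C →L[ℂ] ℂ, IsTracialState σ → σ = τ) (hσ : IsTracialState σ)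
    {g : D →⋆ₙₐ[ℂ] Matrix (Fin n) (Fin n) C} (hg : IsCornerEmbedding_s10 g)
    {h : C →⋆ₙₐ[ℂ] Matrix (Fin m) (Fin m) D} (hh : IsCornerEmbedding_s10 h)
    (hgh : σ (h 1).trace * τ (g 1).trace = 1) : fundGroup C τ ⊆ fundGroup D σ := by
  intro t ht
  obtain ⟨k, f, hf, rfl⟩ := mem_fundGroup_iff.mp ht
  refine mem_fundGroup_iff.mpr ⟨_, _, hh.amplify_comp (hf.amplify_comp hg), ?_⟩
  simp only [NonUnitalStarAlgHom.comp_apply, trace_amplify]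
  rw [trace_apply_eq_mul hτ hτu hσ h, trace_apply_eq_mul hτ hτu hτ f (g 1).trace,
    mul_left_comm, hgh, mul_one]

end

section

variable {A B : Type*} [CStarAlgebra A] [CStarAlgebra B] {n : ℕ}

theorem sum_mul_apply_of_mul_eq {x y z : Matrix (Fin n) (Fin n) A} (h : x * y = z)
    (i j : Fin n) : ∑ k, x i k * y k j = z i j := by
  rw [← Matrix.mul_apply, h]

theorem exists_frame [IsSimpleRing A] {p : Matrix (Fin n) (Fin n) A} (hp : p * p = p)
    (hps : star p = p) (hpne : p ≠ 0) : ∃ (m : ℕ) (X : Fin m → Fin n → A),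
      (∀ i k, ∑ l, p k l * X i l = X i k) ∧ ∑ i, ∑ l, star (X i l) * X i l = 1 := by
  let _ := CStarAlgebra.spectralOrder A
  have _ := CStarAlgebra.spectralOrderedRing A
  have hstar (i j) : star (p i j) = p j i := by rw [← Matrix.star_apply, hps]
  have hsq (k) : p k k = ∑ l, star (p l k) * p l k := by
    simp only [hstar, sum_mul_apply_of_mul_eq hp]
  obtain ⟨k, hk⟩ : ∃ k, p k k ≠ 0 := by
    by_contra! h
    refine hpne (Matrix.ext fun l k => ?_)
    have h0 := (Finset.sum_eq_zero_iff_of_nonneg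
      fun l _ => star_mul_self_nonneg (p l k)).mp ((hsq k).symm.trans (h k)) l (Finset.mem_univ l)
    exact CStarRing.star_mul_self_eq_zero_iff _ |>.mp h0
  have hk0 : 0 ≤ p k k := by
    rw [hsq]; exact Finset.sum_nonneg fun l _ => star_mul_self_nonneg _
  obtain ⟨m, c, hc⟩ := CStarAlgebra.exists_sum_star_mul_mul_eq_one hk0 hk
  refine ⟨m, fun i l => p l k * c i, fun i j => ?_, ?_⟩
  · simp only [← mul_assoc, ← Finset.sum_mul, sum_mul_apply_of_mul_eq hp]
  · rw [← hc]
    refine Finset.sum_congr rfl fun i _ => ?_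
    rw [hsq k, Finset.mul_sum, Finset.sum_mul]
    simp only [star_mul, mul_assoc]

theorem trace_ne_zero [IsSimpleRing A] {τ : A →L[ℂ] ℂ} (hτ : IsTracialState τ)
    {p : Matrix (Fin n) (Fin n) A} (hp : p * p = p) (hps : star p = p) (hpne : p ≠ 0) :
    τ p.trace ≠ 0 := by
  intro h
  have hstar (i j) : star (p i j) = p j i := by rw [← Matrix.star_apply, hps]
  have h0 : ∑ k, ∑ l, τ (star (p l k) * p l k) = 0 := by
    rw [← h, Matrix.trace, map_sum]
    simp only [← map_sum, hstar, sum_mul_apply_of_mul_eq hp, Matrix.diag_apply]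
  refine hpne (Matrix.ext fun l k => hτ.eq_zero_of_apply_star_mul_self ?_)
  have h1 := (Finset.sum_eq_zero_iff_of_nonneg fun k _ =>
    Finset.sum_nonneg fun l _ => hτ.1 (p l k)).mp h0 k (Finset.mem_univ k)
  exact (Finset.sum_eq_zero_iff_of_nonneg fun l _ => hτ.1 (p l k)).mp h1 l (Finset.mem_univ l)

variable {f : B →⋆ₙₐ[ℂ] Matrix (Fin n) (Fin n) A}

theorem IsCornerEmbedding_s10.exists_sum_mul_mul_eq_one [IsSimpleRing A] (hf : IsCornerEmbedding_s10 f)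
    {b : B} (hb : b ≠ 0) : ∃ (m : ℕ) (x y : Fin m → B), ∑ i, x i * b * y i = 1 := by
  have hne : f b ≠ 0 := fun h => hb (hf.injective (h.trans (map_zero f).symm))
  have : Nonempty (Fin n) := by
    by_contra h
    rw [not_nonempty_iff] at h
    exact hne (Subsingleton.elim _ _)
  have h11 : f 1 * f 1 = f 1 := by rw [← map_mul, one_mul]
  obtain ⟨m, x, y, h⟩ := IsSimpleRing.exists_sum_mul_mul_eq_one hne
  have hex (z) : ∃ c, f c = f 1 * z * f 1 :=
    hf.exists_eq _ (by simp only [← mul_assoc, h11]) (by simp only [mul_assoc, h11])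
  choose c hc using hex
  refine ⟨m, fun i => c (x i), fun i => c (y i), hf.injective ?_⟩
  have h1b : f 1 * f b * f 1 = f b := by simp only [← map_mul, one_mul, mul_one]
  calc f (∑ i, c (x i) * b * c (y i))
      = ∑ i, f 1 * x i * (f 1 * f b * f 1) * y i * f 1 := by
        simp only [map_sum, map_mul, hc, mul_assoc]
    _ = f 1 * (∑ i, x i * f b * y i) * f 1 := by
        simp only [h1b, Finset.mul_sum, Finset.sum_mul, mul_assoc]
    _ = f 1 := by rw [h, mul_one, h11]

theorem IsCornerEmbedding_s10.exists_inverse [IsSimpleRing A] (hf : IsCornerEmbedding_s10 f)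
    (hne : f 1 ≠ 0) : ∃ (m : ℕ) (h : A →⋆ₙₐ[ℂ] Matrix (Fin m) (Fin m) B), IsCornerEmbedding_s10 h ∧
      ∀ σ : B →ₗ[ℂ] ℂ, (∀ x y, σ (x * y) = σ (y * x)) → ∀ b, σ (h (f b).trace).trace = σ b := by
  have hpp : f 1 * f 1 = f 1 := by rw [← map_mul, one_mul]
  have hps : star (f 1) = f 1 := by rw [← map_star, star_one]
  obtain ⟨m, X, hX, hX1⟩ := exists_frame hpp hps hne
  have hstar (i j) : star (f 1 i j) = f 1 j i := by rw [← Matrix.star_apply, hps]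
  have hX' (i k) : ∑ l, star (X i l) * f 1 l k = star (X i k) := by
    simp only [← hX i k, star_sum, star_mul, hstar]
  let W (i j : Fin m) (a : A) : Matrix (Fin n) (Fin n) A :=
    .of fun k l => X i k * a * star (X j l)
  have hW (i j a) : ∃ b, f b = W i j a := by
    apply hf.exists_eq <;> ext k l
    · simp only [Matrix.mul_apply, W, Matrix.of_apply, ← mul_assoc, ← Finset.sum_mul, hX]
    · simp only [Matrix.mul_apply, W, Matrix.of_apply, mul_assoc, ← Finset.mul_sum, hX']
  choose t ht using hW
  let h : A →⋆ₙₐ[ℂ] Matrix (Fin m) (Fin m) B :=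
    { toFun := fun a => .of fun i j => t i j a
      map_smul' := fun c a => by
        ext i j
        refine hf.injective ?_
        ext k l
        simp [map_smul, ht, W]
      map_zero' := by
        ext i j
        refine hf.injective ?_
        ext k l
        simp [ht, W]
      map_add' := fun a b => by
        ext i j
        refine hf.injective ?_
        ext k l
        simp [map_add, ht, W, mul_add, add_mul]
      map_mul' := fun a b => by
        ext i j
        refine hf.injective ?_
        ext k l
        simp only [Matrix.mul_apply, Matrix.of_apply, map_sum, map_mul, ht, Matrix.sum_apply, W]
        calc X i k * (a * b) * star (X j l)
            = X i k * a * (∑ s, ∑ r, star (X s r) * X s r) * b * star (X j l) := by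
              rw [hX1]; simp only [mul_one, mul_assoc]
          _ = _ := by simp only [Finset.mul_sum, Finset.sum_mul, mul_assoc]
      map_star' := fun a => by
        ext i j
        refine hf.injective ?_
        ext k l
        simp [map_star, ht, W, Matrix.star_apply, mul_assoc] }
  have hh (a i j) : f (h a i j) = W i j a := ht i j a
  refine ⟨m, h, ⟨fun a b hab => ?_, fun y hy1 hy2 => ?_⟩, fun σ hσ b => ?_⟩
  · have key (a : A) : ∑ i, ∑ k, ∑ j, ∑ l, star (X i k) * W i j a k l * X j l = a := by
      calc _ = (∑ i, ∑ k, star (X i k) * X i k) * a * (∑ j, ∑ l, star (X j l) * X j l) := by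
            simp only [W, Matrix.of_apply, Finset.sum_mul]
            simp only [Finset.mul_sum, mul_assoc]
        _ = a := by rw [hX1, one_mul, mul_one]
    rw [← key a, ← key b]
    simp only [← hh, hab]
  · refine ⟨∑ j, ∑ i, ∑ k, ∑ l, star (X i k) * f (y i j) k l * X j l, ?_⟩
    ext r s
    refine hf.injective ?_
    have hy : h 1 * y * h 1 = y := by rw [hy1, hy2]
    rw [hh]
    conv_rhs => rw [← hy]
    ext u v
    simp only [Matrix.mul_apply, map_sum, map_mul, hh, Matrix.sum_apply, W, Matrix.of_apply,
      one_mul, Finset.mul_sum, Finset.sum_mul, mul_assoc]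
  · let U (i : Fin m) (k : Fin n) : Matrix (Fin n) (Fin n) A := .of fun r s => X i r * f 1 k s
    have hU (i k) : ∃ c, f c = U i k := by
      apply hf.exists_eq <;> ext r s
      · simp only [Matrix.mul_apply, U, Matrix.of_apply, ← mul_assoc, ← Finset.sum_mul, hX]
      · simp only [Matrix.mul_apply, U, Matrix.of_apply, mul_assoc, ← Finset.mul_sum,
          sum_mul_apply_of_mul_eq hpp]
    choose c hc using hU
    have h1 : ∑ i, ∑ k, star (c i k) * c i k = 1 := by
      refine hf.injective ?_
      ext r s
      simp only [map_sum, map_mul, map_star, hc, Matrix.sum_apply, Matrix.mul_apply,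
        Matrix.star_apply, U, Matrix.of_apply, star_mul, hstar]
      rw [Finset.sum_comm]
      calc _ = ∑ k, f 1 r k * (∑ i, ∑ l, star (X i l) * X i l) * f 1 k s := by
            simp only [Finset.mul_sum, Finset.sum_mul, mul_assoc]
        _ = _ := by simp only [hX1, mul_one, sum_mul_apply_of_mul_eq hpp]
    have h2 (i k) : h (f b k k) i i = c i k * b * star (c i k) := by
      refine hf.injective ?_
      ext r s
      have hb1 : f 1 * f b = f b := by rw [← map_mul, one_mul]
      have hb2 : f b * f 1 = f b := by rw [← map_mul, mul_one]
      simp only [hh, map_mul, map_star, hc, Matrix.mul_apply, U, W, Matrix.of_apply,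
        Matrix.star_apply, star_mul, hstar, mul_assoc, ← Finset.mul_sum]
      simp only [← mul_assoc, ← Finset.sum_mul, sum_mul_apply_of_mul_eq hb2,
        sum_mul_apply_of_mul_eq hb1]
    calc σ (h (f b).trace).trace = ∑ i, ∑ k, σ (c i k * b * star (c i k)) := by
          simp only [Matrix.trace, Matrix.diag_apply, map_sum, Matrix.sum_apply, h2]
      _ = σ ((∑ i, ∑ k, star (c i k) * c i k) * b) := by
          simp only [Finset.sum_mul, map_sum]
          refine Finset.sum_congr rfl fun i _ => Finset.sum_congr rfl fun k _ => ?_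
          rw [hσ, mul_assoc]
      _ = σ b := by rw [h1, one_mul]

end

/-- Let `A` be a simple unital C*-algebra with a unique tracial state `τ`, let `p` be a nonzero
projection in `M_n(A)`, and let `B` be a unital C*-algebra *-isomorphic (via `ψ`) to the corner
`p·M_n(A)·p`. Then `B` is simple (nontrivial, with no proper nonzero closed two-sided ideals),
`B` has a unique tracial state, and `𝓕(B) = 𝓕(A)`. -/
theorem fundGroup_corner_eq {A B : Type*} [CStarAlgebra A] [Nontrivial A] [CStarAlgebra B]
    (hsimple : ∀ I : TwoSidedIdeal A, IsClosed (I : Set A) → I = ⊥ ∨ I = ⊤)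
    (τ : A →L[ℂ] ℂ) (hτ : IsTracialState τ)
    (huniq : ∀ σ : A →L[ℂ] ℂ, IsTracialState σ → σ = τ)
    {n : ℕ} (p : Matrix (Fin n) (Fin n) A) (hp : p * p = p) (hps : star p = p) (hpne : p ≠ 0)
    (ψ : B ≃⋆ₐ[ℂ] corner p hp hps) :
    Nontrivial B ∧
    (∀ J : TwoSidedIdeal B, IsClosed (J : Set B) → J = ⊥ ∨ J = ⊤) ∧
    (∃ σ : B →L[ℂ] ℂ, IsTracialState σ) ∧
    (∀ σ σ' : B →L[ℂ] ℂ, IsTracialState σ → IsTracialState σ' → σ = σ') ∧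
    (∀ σ : B →L[ℂ] ℂ, IsTracialState σ → fundGroup B σ = fundGroup A τ) := by
  have := isSimpleRing_of_isClosed hsimple
  obtain ⟨f, hf, rfl⟩ := exists_isCornerEmbedding_s10 ψ
  obtain ⟨m, h, hh, htr⟩ := hf.exists_inverse hpne
  have hform (σ : B →L[ℂ] ℂ) (hσ : IsTracialState σ) (b : B) :
      σ b = σ (h 1).trace * τ (f b).trace := by
    rw [← trace_apply_eq_mul hτ huniq hσ]
    exact (htr σ hσ.2.2 b).symm
  have hone (σ : B →L[ℂ] ℂ) (hσ : IsTracialState σ) : σ (h 1).trace * τ (f 1).trace = 1 := by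
    rw [← hform σ hσ, hσ.2.1]
  have hBuniq (σ σ' : B →L[ℂ] ℂ) (hσ : IsTracialState σ) (hσ' : IsTracialState σ') : σ = σ' := by
    ext b
    rw [hform σ hσ, hform σ' hσ', eq_inv_of_mul_eq_one_left (hone σ hσ),
      eq_inv_of_mul_eq_one_left (hone σ' hσ')]
  refine ⟨⟨1, 0, fun h0 => hpne (by rw [h0, map_zero])⟩, fun J _ => ?_, ?_, hBuniq,
    fun σ hσ => ?_⟩
  · refine or_iff_not_imp_left.mpr fun hJ => ?_
    obtain ⟨b, hbJ, hb⟩ : ∃ b ∈ J, b ≠ 0 := by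
      by_contra! h0
      exact hJ (eq_bot_iff.mpr fun b hb => (TwoSidedIdeal.mem_bot B).mpr (h0 b hb))
    obtain ⟨k, x, y, hxy⟩ := hf.exists_sum_mul_mul_eq_one hb
    rw [← TwoSidedIdeal.one_mem_iff, ← hxy]
    exact sum_mem fun i _ => J.mul_mem_right _ _ (J.mul_mem_left _ _ hbJ)
  · obtain ⟨σ, hσ, -⟩ := (hτ.isPosTrace.comp_trace.comp_hom f).exists_isTracialState
      (trace_ne_zero hτ hp hps hpne)
    exact ⟨σ, hσ⟩
  · exact (fundGroup_subset hσ (fun σ' hσ' => hBuniq σ' σ hσ' hσ) hτ hh hf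
      (by rw [mul_comm]; exact hone σ hσ)).antisymm
      (fundGroup_subset hτ huniq hσ hf hh (hone σ hσ))
end
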